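/- arXiv:1608.04012 — 3 statements merged into one kernel-verified Lean document; each statement's English description precedes it below -/
import Mathlib

section
/- Let K be a field equipped with a derivation ∂, and let A be a unital K-module (or K-algebra) equipped with an additive map ∇¹ : A → A satisfying the connection property ∇¹(f • x) = f • ∇¹x + (∂f) • x for all f ∈ K, x ∈ A. Let ψ, η, z ∈ K with ψ ≠ 0, and let e, s ∈ A satisfy ∇¹e = (−ψ)•s and ∇¹s + η•s + (4·z·ψ)•e = 0. Then ∇¹(∇¹e) + (η − (∂ψ)/ψ)•(∇¹e) − (4·z·ψ²)•e = 0. -/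
/-- the second-order equation (2.22) for the identity element e,
obtained by eliminating s from ∇¹e = −ψ•s and ∇¹s + η•s + 4zψ•e = 0. -/
theorem second_order_equation_for_e
    {K : Type*} [Field K] (D : K → K)
    (hDadd : ∀ x y : K, D (x + y) = D x + D y)
    (hDmul : ∀ x y : K, D (x * y) = D x * y + x * D y)
    {A : Type*} [AddCommGroup A] [Module K A] (N : A → A)
    (hNadd : ∀ x y : A, N (x + y) = N x + N y)
    (hNconn : ∀ (f : K) (x : A), N (f • x) = f • N x + (D f) • x)
    (ψ η z : K) (hψ : ψ ≠ 0) (e s : A)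
    (he : N e = (-ψ) • s)
    (hs : N s + η • s + (4 * z * ψ) • e = 0) :
    N (N e) + (η - D ψ / ψ) • (N e) - (4 * z * ψ ^ 2) • e = 0 := by
  have hD0 : D 0 = 0 := by simpa using hDadd 0 0
  have hDneg : D (-ψ) = -D ψ :=
    eq_neg_of_add_eq_zero_left (by rw [← hDadd, neg_add_cancel, hD0])
  have hNs : N s = -(η • s) - (4 * z * ψ) • e := by
    rw [add_assoc] at hs
    rw [eq_neg_of_add_eq_zero_left hs]
    abel
  rw [he, hNconn, hDneg, hNs]
  match_scalars <;> field_simp <;> ring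
end

section
/- Let α : ℝ → ℝ be continuous and set A(s) := ∫₀ˢ α(τ) dτ. Let v : ℝ² → ℂ be continuously differentiable with v(s, t+1) = v(s, t) for all (s, t). Then v satisfies ∂ₛv(s,t) + i·∂ₜv(s,t) − 2π·α(s)·v(s,t) = 0 for all (s, t) if and only if there exists a holomorphic function w on ℂ ∖ {0} such that v(s, t) = exp(2π·A(s)) · w(exp(2π(s + i t))) for all (s, t). -/
open Filter Topology

/-- With a real integrating factor `ρ` of derivative `-a ρ`, the function `ρ(re z) v(re z, im z)` is
complex differentiable iff `v` solves the Cauchy-Riemann equation perturbed by the zeroth order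
term `-a v`. -/
theorem differentiableAt_integratingFactor_mul_iff {ρ : ℝ → ℝ} {a : ℝ} {v : ℝ × ℝ → ℂ} {z : ℂ}
    (hρ : HasDerivAt ρ (-a * ρ z.re) z.re) (hρ0 : ρ z.re ≠ 0)
    (hv : DifferentiableAt ℝ v (z.re, z.im)) :
    DifferentiableAt ℂ (fun z : ℂ ↦ (ρ z.re : ℂ) * v (z.re, z.im)) z ↔
      fderiv ℝ v (z.re, z.im) (1, 0) + Complex.I * fderiv ℝ v (z.re, z.im) (0, 1)
        - (a : ℂ) * v (z.re, z.im) = 0 := by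
  have hcoord : HasFDerivAt (fun z : ℂ ↦ (z.re, z.im)) (Complex.reCLM.prod Complex.imCLM) z :=
    (Complex.reCLM.prod Complex.imCLM).hasFDerivAt
  have hfactor : HasFDerivAt (fun z : ℂ ↦ (ρ z.re : ℂ)) _ z :=
    Complex.ofRealCLM.hasFDerivAt.comp z (hρ.hasFDerivAt.comp z Complex.reCLM.hasFDerivAt)
  have hprod : HasFDerivAt (fun z : ℂ ↦ (ρ z.re : ℂ) * v (z.re, z.im)) _ z :=
    hfactor.mul (HasFDerivAt.comp (g := v) z hv.hasFDerivAt hcoord)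
  have hρ0' : (ρ z.re : ℂ) ≠ 0 := mod_cast hρ0
  have hI : Complex.I * Complex.I = -1 := Complex.I_mul_I
  rw [differentiableAt_complex_iff_differentiableAt_real,
    and_iff_right hprod.differentiableAt, hprod.fderiv]
  simp only [Complex.coe_smul, neg_mul, add_apply, smul_apply, ContinuousLinearMap.comp_apply,
    ContinuousLinearMap.prod_apply, Complex.reCLM_apply, Complex.I_re, Complex.imCLM_apply,
    Complex.I_im, Complex.real_smul, ContinuousLinearMap.toSpanSingleton_apply, smul_eq_mul,
    mul_neg, zero_mul, neg_zero, Complex.ofRealCLM_apply, Complex.ofReal_zero, mul_zero, add_zero,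
    Complex.one_re, Complex.one_im, one_mul, Complex.ofReal_neg, Complex.ofReal_mul]
  constructor
  · intro h
    apply mul_left_cancel₀ hρ0'
    linear_combination Complex.I * h +
      ρ z.re * (fderiv ℝ v (z.re, z.im) (1, 0) - a * v (z.re, z.im)) * hI
  · intro h
    linear_combination (-Complex.I * ρ z.re) * h + ρ z.re * fderiv ℝ v (z.re, z.im) (0, 1) * hI

/-- A function on `ℂ` with period `i` is entire iff it descends along `z ↦ exp (2πz)` to a
holomorphic function on the punctured plane. -/
theorem differentiable_iff_exists_comp_exp {f : ℂ → ℂ} (hf : Function.Periodic f Complex.I) :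
    Differentiable ℂ f ↔ ∃ w : ℂ → ℂ, DifferentiableOn ℂ w {z : ℂ | z ≠ 0} ∧
      ∀ z, f z = w (Complex.exp (2 * (Real.pi : ℂ) * z)) := by
  constructor
  · intro hd
    have hper : Function.Periodic (fun z ↦ f (Complex.I * z)) (1 : ℝ) := fun z ↦ by
      simpa [mul_add] using hf (Complex.I * z)
    refine ⟨Function.Periodic.cuspFunction 1 fun z ↦ f (Complex.I * z), fun q hq ↦ ?_, fun z ↦ ?_⟩
    · rw [← Function.Periodic.qParam_right_inv one_ne_zero hq]
      refine (Function.Periodic.differentiableAt_cuspFunction one_ne_zero hper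
        ?_).differentiableWithinAt
      fun_prop
    · have h := Function.Periodic.eq_cuspFunction one_ne_zero hper (-Complex.I * z)
      have hz : Complex.I * (-Complex.I * z) = z := by
        linear_combination -z * Complex.I_mul_I
      rw [hz] at h
      rw [← h, Function.Periodic.qParam]
      congr 2
      rw [Complex.ofReal_one, div_one]
      linear_combination -2 * (Real.pi : ℂ) * z * Complex.I_mul_I
  · rintro ⟨w, hw, hfw⟩ z
    rw [funext hfw]
    have hwz : DifferentiableAt ℂ w (Complex.exp (2 * (Real.pi : ℂ) * z)) :=
      hw.differentiableAt (isOpen_ne.mem_nhds (Complex.exp_ne_zero _))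
    exact hwz.comp z (by fun_prop)

/-- representation (5.17)/(5.34) of solutions of the linear
equation ∂ₛv + i∂ₜv − 2πα(s)v = 0 on the cylinder: they are exactly of the
form v(s,t) = exp(2π∫₀ˢα)·w(exp(2π(s+it))) with w holomorphic on ℂ∖{0}. -/
theorem cylinder_solution_representation
    (α : ℝ → ℝ) (hα : Continuous α)
    (v : ℝ × ℝ → ℂ) (hv : ContDiff ℝ 1 v)
    (hper : ∀ s t : ℝ, v (s, t + 1) = v (s, t)) :
    (∀ p : ℝ × ℝ,
        fderiv ℝ v p (1, 0) + Complex.I * fderiv ℝ v p (0, 1)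
          - ((2 * Real.pi * α p.1 : ℝ) : ℂ) * v p = 0)
      ↔ ∃ w : ℂ → ℂ, DifferentiableOn ℂ w {z : ℂ | z ≠ 0} ∧
          ∀ p : ℝ × ℝ,
            v p = ((Real.exp (2 * Real.pi * ∫ τ in (0:ℝ)..p.1, α τ) : ℝ) : ℂ)
              * w (Complex.exp (2 * (Real.pi : ℂ) * ((p.1 : ℂ) + (p.2 : ℂ) * Complex.I))) := by
  set A : ℝ → ℝ := fun s ↦ ∫ τ in (0:ℝ)..s, α τ
  set ρ : ℝ → ℝ := fun s ↦ Real.exp (-(2 * Real.pi * A s))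
  have hρ (s : ℝ) : HasDerivAt ρ (-(2 * Real.pi * α s) * ρ s) s := by
    rw [mul_comm]
    exact ((hα.integral_hasStrictDerivAt 0 s).hasDerivAt.const_mul _).neg.exp
  set f : ℂ → ℂ := fun z ↦ (ρ z.re : ℂ) * v (z.re, z.im)
  have hf : Function.Periodic f Complex.I := fun z ↦ by simp [f, hper]
  have hfv (p : ℝ × ℝ) (c : ℂ) :
      f (p.1 + p.2 * Complex.I) = c ↔ v p = (Real.exp (2 * Real.pi * A p.1) : ℂ) * c := by
    have hne : (Real.exp (2 * Real.pi * A p.1) : ℂ) ≠ 0 := mod_cast Real.exp_ne_zero _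
    simp only [f, ρ, Complex.add_re, Complex.add_im, Complex.ofReal_re, Complex.ofReal_im,
      Complex.re_ofReal_mul, Complex.im_ofReal_mul, Complex.I_re, Complex.I_im, mul_zero, mul_one,
      add_zero, zero_add, Real.exp_neg, Complex.ofReal_inv]
    exact inv_mul_eq_iff_eq_mul₀ hne
  calc _ ↔ Differentiable ℂ f := by
        rw [Differentiable, ← Complex.equivRealProd.forall_congr_right]
        refine forall_congr' fun z ↦ ?_
        exact (differentiableAt_integratingFactor_mul_iff (hρ z.re) (Real.exp_ne_zero _)
          (hv.differentiable one_ne_zero _)).symm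
    _ ↔ _ := by
        rw [differentiable_iff_exists_comp_exp hf]
        refine exists_congr fun w ↦ and_congr_right fun _ ↦ ?_
        rw [← Complex.equivRealProd.symm.forall_congr_right]
        refine forall_congr' fun p ↦ ?_
        rw [Complex.equivRealProd_symm_apply]
        exact hfv p _
end

section
/- Let K be a field of characteristic zero equipped with a derivation ∂. Let h ∈ K with ∂h = 1, let f ∈ K with f ≠ 0 and set l := (∂f)/f, and let p₀ ∈ K be a constant (∂p₀ = 0) with p₀·h − 1 ≠ 0. Then a := p₀/(p₀·h − 1) − l satisfies ∂a + a² + 2·l·a + (∂l + l²) = 0. -/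
/-- equations (4.21)–(4.22) of the paper's mirror symmetry
discussion: a = p₀/(p₀h − 1) − l with l = (∂f)/f satisfies the Riccati
equation ∂a + a² + 2la + (∂l + l²) = 0. -/
theorem mirror_riccati
    {K : Type*} [Field K] [CharZero K] (D : K → K)
    (hadd : ∀ x y : K, D (x + y) = D x + D y)
    (hmul : ∀ x y : K, D (x * y) = D x * y + x * D y)
    (h f p₀ : K) (hh : D h = 1) (hf : f ≠ 0)
    (hp₀ : D p₀ = 0) (hden : p₀ * h - 1 ≠ 0) :
    D (p₀ / (p₀ * h - 1) - D f / f)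
      + (p₀ / (p₀ * h - 1) - D f / f) ^ 2
      + 2 * (D f / f) * (p₀ / (p₀ * h - 1) - D f / f)
      + (D (D f / f) + (D f / f) ^ 2) = 0 := by
  set q := p₀ * h - 1 with hq
  set l := D f / f
  set u := p₀ / q
  have h_one : D 1 = 0 := by simpa using hmul 1 1
  have h_q : D q = p₀ := by
    have e := hadd q 1
    rwa [hq, sub_add_cancel, hmul, hp₀, hh, h_one, zero_mul, zero_add, mul_one, add_zero,
      eq_comm] at e
  have h_uq : u * q = p₀ := div_mul_cancel₀ p₀ hden
  have h_u : D u = -u ^ 2 := by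
    have e := hmul u q
    rw [h_uq, hp₀, h_q] at e
    apply mul_right_cancel₀ hden
    linear_combination -e + u * h_uq
  have h_sub : D u = D (u - l) + D l := by rw [← hadd, sub_add_cancel]
  linear_combination h_u - h_sub
end
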